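/- Let B be the set of tuples (e, k, ℓ, a) where e is a real number with e ≥ 0, k and ℓ are natural numbers, and a : Fin ℓ → ℕ is weakly decreasing, equipped with the order: (e,k,ℓ,a) < (e′,k′,ℓ′,a′) iff e < e′, or (e = e′ and k < k′), or (e = e′, k = k′ and ℓ < ℓ′), or (e = e′, k = k′, ℓ = ℓ′ and there exists i with a i < a′ i and a j = a′ j for all j > i). Fix a real number ħ > 0 and define the relation R on B by: x R y iff x < y and moreover either the first component of x equals the first component of y, or the first component of x is ≤ (first component of y) − ħ. Then R is well-founded; in particular there is no infinite sequence x₀, x₁, x₂, … in B with x_{n+1} R x_n for all n. -/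

import Mathlib

/-- An element of the set `B`: energy `e ≥ 0`, number of boundary constraints `k`,
number of interior constraints `ℓ`, and a weakly decreasing vector of degrees `a`. -/
structure BTuple where
  e : ℝ
  he : 0 ≤ e
  k : ℕ
  ℓ : ℕ
  a : Fin ℓ → ℕ
  ha : ∀ i j : Fin ℓ, i ≤ j → a j ≤ a i

/-- The order on `B` from the paper. -/
def BLt (x y : BTuple) : Prop :=
  x.e < y.e ∨
  (x.e = y.e ∧ x.k < y.k) ∨
  (x.e = y.e ∧ x.k = y.k ∧ x.ℓ < y.ℓ) ∨
  (x.e = y.e ∧ x.k = y.k ∧ ∃ h : x.ℓ = y.ℓ, ∃ i : Fin x.ℓ,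
    x.a i < y.a (Fin.cast h i) ∧ ∀ j : Fin x.ℓ, i < j → x.a j = y.a (Fin.cast h j))

/-- The recursion relation: a strict decrease in the order, where the energy either
stays the same or drops by at least `hbar`. -/
def BRel (hbar : ℝ) (x y : BTuple) : Prop :=
  BLt x y ∧ (x.e = y.e ∨ x.e ≤ y.e - hbar)

/-- Colexicographic order on degree vectors of fixed length. -/
def vecLt (n : ℕ) (u v : Fin n → ℕ) : Prop :=
  ∃ i : Fin n, (∀ j, i < j → u j = v j) ∧ u i < v i

theorem vecLt_wf (n : ℕ) : WellFounded (vecLt n) := by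
  have h : WellFounded (Pi.Lex (fun a b : Fin n => b < a)
      (fun {_} (a b : ℕ) => a < b)) :=
    Pi.Lex.wellFounded (fun a b : Fin n => b < a)
      (s := fun _ (a b : ℕ) => a < b) (fun _ => Nat.lt_wfRel.wf)
  exact h

theorem psigma_left (k ℓ k' ℓ' : ℕ) (a : Fin ℓ → ℕ) (a' : Fin ℓ' → ℕ)
    (h : ℓ = ℓ') (hk : k = k') (i : Fin ℓ) (hi : a i < a' (Fin.cast h i))
    (hj : ∀ j : Fin ℓ, i < j → a j = a' (Fin.cast h j)) :
    Prod.Lex (· < ·) (PSigma.Lex (· < ·) vecLt)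
      (k, (⟨ℓ, a⟩ : Σ' n : ℕ, Fin n → ℕ)) (k', ⟨ℓ', a'⟩) := by
  subst h hk
  exact Prod.Lex.right _ (PSigma.Lex.right _ ⟨i, hj, hi⟩)

theorem BRel_wf (hbar : ℝ) (h_hbar : 0 < hbar) : WellFounded (BRel hbar) := by
  have hlt : WellFounded (fun a b : ℕ => a < b) := Nat.lt_wfRel.wf
  have hS : WellFounded (PSigma.Lex (fun a b : ℕ => a < b) vecLt) :=
    WellFounded.psigma_lex hlt vecLt_wf
  have hP : WellFounded (Prod.Lex (fun a b : ℕ => a < b)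
      (PSigma.Lex (fun a b : ℕ => a < b) vecLt)) := WellFounded.prod_lex hlt hS
  have hQ := WellFounded.prod_lex hlt hP
  refine Subrelation.wf (r := InvImage _ (fun x : BTuple =>
    (⌊x.e / hbar⌋₊, (x.k, (⟨x.ℓ, x.a⟩ : Σ' n : ℕ, Fin n → ℕ))))) ?_ (InvImage.wf _ hQ)
  rintro x y ⟨hxy, he⟩
  show Prod.Lex _ _ _ _
  rcases he with he | he
  · have hf : ⌊x.e / hbar⌋₊ = ⌊y.e / hbar⌋₊ := by rw [he]
    simp only [hf]
    refine Prod.Lex.right _ ?_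
    rcases hxy with h | ⟨_, h⟩ | ⟨_, hk, h⟩ | ⟨_, hk, h, i, hi, hj⟩
    · exact absurd he h.ne
    · exact Prod.Lex.left _ _ h
    · rw [hk]
      exact Prod.Lex.right _ (PSigma.Lex.left _ _ h)
    · exact psigma_left _ _ _ _ _ _ h hk i hi hj
  · refine Prod.Lex.left _ _ ?_
    have h1 : x.e / hbar + 1 ≤ y.e / hbar := by
      rw [← sub_nonneg]
      have : y.e / hbar - (x.e / hbar + 1) = (y.e - hbar - x.e) / hbar := by
        field_simp
        ring
      rw [this]
      exact div_nonneg (by linarith) h_hbar.le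
    have h2 := Nat.floor_le_floor h1
    rw [Nat.floor_add_one (div_nonneg x.he h_hbar.le)] at h2
    exact h2

theorem stmt_7 (hbar : ℝ) (h_hbar : 0 < hbar) :
    WellFounded (BRel hbar) ∧
    ∀ f : ℕ → BTuple, ¬ (∀ n : ℕ, BRel hbar (f (n + 1)) (f n)) := by
  have h := BRel_wf hbar h_hbar
  refine ⟨h, fun f hf => ?_⟩
  exact (wellFounded_iff_isEmpty_descending_chain.1 h).false ⟨f, hf⟩
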